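/- arXiv:1207.2485 — 2 statements merged into one kernel-verified Lean document; each statement's English description precedes it below -/
import Mathlib

section
/- Let M ≥ 2 and r ≥ 2 be integers, let x be a real number with π/(2M) ≤ x < π/2, and set W = 1 + i·(x/r) − (x/r)². Then |e^{i x} − W^r| ≤ 2^7 / r. -/
open Real

/-- On the closed unit disc, `a ↦ a ^ n` is `n`-Lipschitz. -/
lemma norm_pow_sub_pow_le_of_norm_le_one {a b : ℂ} (ha : ‖a‖ ≤ 1) (hb : ‖b‖ ≤ 1) (n : ℕ) :
    ‖a ^ n - b ^ n‖ ≤ n * ‖a - b‖ := by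
  induction n with
  | zero => simp
  | succ n ih =>
    have hbn : ‖b ^ n‖ ≤ 1 := by
      rw [norm_pow]
      exact pow_le_one₀ (norm_nonneg b) hb
    calc ‖a ^ (n + 1) - b ^ (n + 1)‖ = ‖a * (a ^ n - b ^ n) + b ^ n * (a - b)‖ := by
          congr 1
          ring
      _ ≤ ‖a‖ * ‖a ^ n - b ^ n‖ + ‖b ^ n‖ * ‖a - b‖ := by
          simpa only [norm_mul] using norm_add_le (a * (a ^ n - b ^ n)) (b ^ n * (a - b))
      _ ≤ 1 * (n * ‖a - b‖) + 1 * ‖a - b‖ := by gcongr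
      _ = (n + 1 : ℕ) * ‖a - b‖ := by
          push_cast
          ring

lemma norm_one_add_I_mul_sub_sq_le_one {t : ℝ} (ht : |t| ≤ 1) :
    ‖1 + Complex.I * t - (t : ℂ) ^ 2‖ ≤ 1 := by
  have h : 1 + Complex.I * t - (t : ℂ) ^ 2 = ((1 - t ^ 2 : ℝ) : ℂ) + (t : ℝ) * Complex.I := by
    push_cast
    ring
  have ht2 : t ^ 2 ≤ 1 := (sq_le_one_iff_abs_le_one t).2 ht
  rw [h, Complex.norm_add_mul_I, Real.sqrt_le_one]
  nlinarith [mul_nonneg (sq_nonneg t) (sub_nonneg.2 ht2)]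

lemma norm_exp_I_mul_sub_le {t : ℝ} (ht : |t| ≤ 1) :
    ‖Complex.exp (Complex.I * t) - (1 + Complex.I * t - (t : ℂ) ^ 2)‖ ≤ 2 * t ^ 2 := by
  have hn : ‖Complex.I * t‖ = |t| := by simp
  have h := Complex.norm_exp_sub_one_sub_id_le (x := Complex.I * t) (hn.trans_le ht)
  rw [hn, sq_abs] at h
  calc ‖Complex.exp (Complex.I * t) - (1 + Complex.I * t - (t : ℂ) ^ 2)‖
      = ‖(Complex.exp (Complex.I * t) - 1 - Complex.I * t) + (t : ℂ) ^ 2‖ := by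
        congr 1
        ring
    _ ≤ ‖Complex.exp (Complex.I * t) - 1 - Complex.I * t‖ + ‖(t : ℂ) ^ 2‖ := norm_add_le _ _
    _ ≤ t ^ 2 + t ^ 2 := by
        gcongr
        simp
    _ = 2 * t ^ 2 := by ring

/-- For integers `M ≥ 2`, `r ≥ 2`, a real `x` with `π/(2M) ≤ x < π/2`, and
`W = 1 + i(x/r) - (x/r)²`, one has `|e^{ix} - W^r| ≤ 2^7 / r`. -/
theorem exp_repeated_squaring_approx (M r : ℕ) (hM : 2 ≤ M) (hr : 2 ≤ r)
    (x : ℝ) (hx1 : π / (2*M) ≤ x) (hx2 : x < π / 2) :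
    ‖Complex.exp (Complex.I * x)
        - (1 + Complex.I * (x / r : ℝ) - ((x / r : ℝ) : ℂ)^2)^r‖
      ≤ 2^7 / r := by
  have hr0 : (0 : ℝ) < r := by positivity
  have hr2 : (2 : ℝ) ≤ r := by exact_mod_cast hr
  have hx0 : 0 ≤ x := le_trans (by positivity) hx1
  have hx : x ≤ 2 := by linarith [Real.pi_le_four]
  have ht : |x / r| ≤ 1 := by
    rw [abs_of_nonneg (by positivity), div_le_one hr0]
    linarith
  have hexp : Complex.exp (Complex.I * x) = Complex.exp (Complex.I * (x / r : ℝ)) ^ r := by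
    have hrC : (r : ℂ) ≠ 0 := by exact_mod_cast hr0.ne'
    rw [← Complex.exp_nat_mul]
    congr 1
    push_cast
    field_simp
  have hnorm : ‖Complex.exp (Complex.I * (x / r : ℝ))‖ ≤ 1 :=
    (Complex.norm_exp_I_mul_ofReal _).le
  rw [hexp]
  calc _ ≤ r * (2 * (x / r) ^ 2) :=
        (norm_pow_sub_pow_le_of_norm_le_one hnorm (norm_one_add_I_mul_sub_sq_le_one ht) r).trans
          (mul_le_mul_of_nonneg_left (norm_exp_I_mul_sub_le ht) hr0.le)
    _ = 2 * x ^ 2 / r := by field_simp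
    _ ≤ 2 ^ 7 / r := by
        gcongr
        nlinarith
end

section
/- Fix integers ν ≥ 1, m ≥ 1, set M = 2^m, r = 2^{ν+7}, and s = max{2ν + 9, 11 + ν + m}. Let x be a real number with π/(2M) ≤ x < π/2 and let Ŵ_r be the fixed-precision repeated-squaring approximation of W^r (with W = 1 − (x/r)² + i·(x/r)) computed with s-bit truncations as in the repeated-squaring scheme. Then |sin x − Im(Ŵ_r)| ≤ 2^{−(ν−1)}. -/
open Real

theorem Complex.norm_le_two_mul_of_abs_re_im_le {z : ℂ} {ε : ℝ} (hre : |z.re| ≤ ε)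
    (him : |z.im| ≤ ε) : ‖z‖ ≤ 2 * ε := by
  linarith [Complex.norm_le_abs_re_add_abs_im z]

/-- Absolute error of inexact repeated squaring inside the closed unit disc. -/
theorem norm_sub_pow_two_pow_le {k : ℕ} {u : ℕ → ℂ} {z : ℂ} {δ : ℝ} (hz : ‖z‖ ≤ 1)
    (hu : ‖u 0‖ ≤ 1) (hnorm : ∀ j < k, ‖u (j + 1)‖ ≤ ‖u j‖ ^ 2)
    (hstep : ∀ j < k, ‖u (j + 1) - u j ^ 2‖ ≤ δ) :
    ‖u k - z ^ 2 ^ k‖ + δ ≤ 2 ^ k * (‖u 0 - z‖ + δ) := by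
  suffices h : ∀ j ≤ k, ‖u j‖ ≤ 1 ∧ ‖u j - z ^ 2 ^ j‖ + δ ≤ 2 ^ j * (‖u 0 - z‖ + δ) from
    (h k le_rfl).2
  intro j hj
  induction j with
  | zero => simpa using hu
  | succ j ih =>
    obtain ⟨h1, h2⟩ := ih (by omega)
    have hpow : ‖z ^ 2 ^ j‖ ≤ 1 := by
      rw [norm_pow]
      exact pow_le_one₀ (norm_nonneg _) hz
    refine ⟨(hnorm j (by omega)).trans (pow_le_one₀ (norm_nonneg _) h1), ?_⟩
    have hsum : ‖u j + z ^ 2 ^ j‖ ≤ 2 := (norm_add_le _ _).trans (by linarith)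
    have hsplit : u (j + 1) - z ^ 2 ^ (j + 1) =
        (u (j + 1) - u j ^ 2) + (u j + z ^ 2 ^ j) * (u j - z ^ 2 ^ j) := by
      rw [pow_succ 2 j, pow_mul]
      ring
    have hle : ‖u (j + 1) - z ^ 2 ^ (j + 1)‖ ≤ δ + 2 * ‖u j - z ^ 2 ^ j‖ := by
      rw [hsplit]
      refine (norm_add_le _ _).trans (add_le_add (hstep j (by omega)) ?_)
      rw [norm_mul]
      gcongr
    have hdouble : (2 : ℝ) ^ (j + 1) = 2 * 2 ^ j := pow_succ' 2 j
    rw [hdouble]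
    linarith

theorem norm_one_sub_sq_add_mul_I_le_one {y : ℝ} (hy : |y| ≤ 1) :
    ‖1 - (y : ℂ) ^ 2 + y * Complex.I‖ ≤ 1 := by
  have h : 1 - (y : ℂ) ^ 2 + y * Complex.I = ((1 - y ^ 2 : ℝ) : ℂ) + y * Complex.I := by
    push_cast
    ring
  rw [h, Complex.norm_add_mul_I, Real.sqrt_le_iff]
  refine ⟨zero_le_one, ?_⟩
  nlinarith [sq_nonneg y, (sq_le_one_iff_abs_le_one y).2 hy]

theorem norm_one_sub_sq_add_mul_I_sub_exp_le {y : ℝ} (hy : |y| ≤ 1) :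
    ‖1 - (y : ℂ) ^ 2 + y * Complex.I - Complex.exp (y * Complex.I)‖ ≤ 2 * y ^ 2 := by
  have hn : ‖(y : ℂ) * Complex.I‖ = |y| := by simp
  have h := Complex.norm_exp_sub_one_sub_id_le (x := y * Complex.I) (by rwa [hn])
  rw [hn, sq_abs] at h
  have hsq : ‖(y : ℂ) ^ 2‖ = y ^ 2 := by simp
  calc ‖1 - (y : ℂ) ^ 2 + y * Complex.I - Complex.exp (y * Complex.I)‖
      = ‖(Complex.exp (y * Complex.I) - 1 - y * Complex.I) + (y : ℂ) ^ 2‖ := by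
        rw [← norm_neg]
        congr 1
        ring
    _ ≤ 2 * y ^ 2 := (norm_add_le _ _).trans (by linarith)

theorem norm_one_sub_sq_add_mul_I_sub_le {y y' : ℝ} (h : |y' + y| ≤ 1) :
    ‖(1 - (y' : ℂ) ^ 2 + y' * Complex.I) - (1 - (y : ℂ) ^ 2 + y * Complex.I)‖
      ≤ 2 * |y' - y| := by
  have hfac : (1 - (y' : ℂ) ^ 2 + y' * Complex.I) - (1 - (y : ℂ) ^ 2 + y * Complex.I) =
      ((y' - y : ℝ) : ℂ) * (Complex.I - ((y' + y : ℝ) : ℂ)) := by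
    push_cast
    ring
  have hI : ‖Complex.I - ((y' + y : ℝ) : ℂ)‖ ≤ 2 := by
    refine (norm_sub_le _ _).trans ?_
    rw [Complex.norm_I, Complex.norm_real, Real.norm_eq_abs]
    linarith
  rw [hfac, norm_mul, Complex.norm_real, Real.norm_eq_abs, mul_comm]
  gcongr

/-- Sine approximation by fixed-precision repeated squaring: with `ν ≥ 1`,
`m ≥ 1`, `M = 2^m`, `r = 2^{ν+7}`, `s = max(2ν+9, 11+ν+m)`,
`π/(2M) ≤ x < π/2`, `y = x/r`, `ŷ` the `s`-bit truncation of `y`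
(`0 ≤ y - ŷ ≤ 2^{-s}`), `Ŵ₁ = Wh 0` the `s`-bit truncation of `1 - ŷ² + iŷ`,
and `Ŵ_r = Wh (ν+7)` obtained by `ν+7` repeated-squaring steps with `s`-bit
truncations, one has `|sin x - Im(Ŵ_r)| ≤ 2^{-(ν-1)}`. -/
theorem sin_fixed_precision_repeated_squaring_error
    (ν m : ℕ) (hν : 1 ≤ ν) (hm : 1 ≤ m) (s : ℕ)
    (hs : s = max (2*ν + 9) (11 + ν + m))
    (x : ℝ) (hx1 : π / (2 * 2^m) ≤ x) (hx2 : x < π / 2)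
    (yh : ℝ) (hy1 : 0 ≤ x / 2^(ν+7) - yh)
    (hy2 : x / 2^(ν+7) - yh ≤ (2:ℝ)^(-(s:ℤ)))
    (Wh : ℕ → ℂ)
    (h0re : |(Wh 0 - (1 - (yh:ℂ)^2 + yh * Complex.I)).re| ≤ (2:ℝ)^(-(s:ℤ)))
    (h0im : |(Wh 0 - (1 - (yh:ℂ)^2 + yh * Complex.I)).im| ≤ (2:ℝ)^(-(s:ℤ)))
    (h0norm : ‖Wh 0‖ ≤ ‖1 - (yh:ℂ)^2 + yh * Complex.I‖)
    (hstepre : ∀ j < ν + 7, |(Wh (j+1) - (Wh j)^2).re| ≤ (2:ℝ)^(-(s:ℤ)))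
    (hstepim : ∀ j < ν + 7, |(Wh (j+1) - (Wh j)^2).im| ≤ (2:ℝ)^(-(s:ℤ)))
    (hstepnorm : ∀ j < ν + 7, ‖Wh (j+1)‖ ≤ ‖Wh j‖^2) :
    |Real.sin x - (Wh (ν+7)).im| ≤ (2:ℝ)^(-((ν:ℤ) - 1)) := by
  have hx0 : 0 < x := lt_of_lt_of_le (by positivity) hx1
  have hx : x < 1.6 := by linarith [Real.pi_lt_d2]
  set ε : ℝ := (2 : ℝ) ^ (-(s : ℤ)) with hε
  set r : ℝ := (2 : ℝ) ^ (ν + 7) with hr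
  have hε0 : 0 < ε := by positivity
  have hp : (0 : ℝ) < 2 ^ ν := by positivity
  have hp2 : (2 : ℝ) ≤ 2 ^ ν := by
    simpa using pow_le_pow_right₀ (one_le_two (α := ℝ)) hν
  have hr' : r = 2 ^ ν * 128 := by
    rw [hr, pow_add]
    norm_num
  have hr0 : 0 < r := by positivity
  have hgoal : (2 : ℝ) ^ (-((ν : ℤ) - 1)) = 2 / 2 ^ ν := by
    rw [neg_sub, zpow_sub₀ two_ne_zero, zpow_one, zpow_natCast]
  have hrε : r * ε ≤ 1 / 4 / 2 ^ ν := by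
    have h : ε ≤ (2 : ℝ) ^ (-((2 * ν + 9 : ℕ) : ℤ)) :=
      zpow_le_zpow_right₀ one_le_two (by omega)
    calc r * ε ≤ r * (2 : ℝ) ^ (-((2 * ν + 9 : ℕ) : ℤ)) := by gcongr
      _ = 1 / 4 / 2 ^ ν := by
        rw [zpow_neg, zpow_natCast, hr', pow_add, pow_mul']
        field_simp
        norm_num
  set y : ℝ := x / r with hy
  have hy0 : 0 < y := by positivity
  have hry : r * y = x := by
    rw [hy]
    field_simp
  have hyle : y ≤ 1 / 100 := by
    rw [hy, div_le_iff₀ hr0]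
    linarith
  have hεle : ε ≤ 1 / 100 := by
    have h : (1 : ℝ) / 4 / 2 ^ ν ≤ 1 / 4 := div_le_self (by norm_num) (by linarith)
    nlinarith
  have hW0 : ‖Wh 0‖ ≤ 1 := h0norm.trans <|
    norm_one_sub_sq_add_mul_I_le_one (abs_le.2 ⟨by linarith, by linarith⟩)
  have hz : ‖Complex.exp (y * Complex.I)‖ ≤ 1 := (Complex.norm_exp_ofReal_mul_I y).le
  have hmain := norm_sub_pow_two_pow_le hz hW0 hstepnorm fun j hj =>
    Complex.norm_le_two_mul_of_abs_re_im_le (hstepre j hj) (hstepim j hj)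
  have hexp : Complex.exp (y * Complex.I) ^ 2 ^ (ν + 7) = Complex.exp (x * Complex.I) := by
    rw [← Complex.exp_nat_mul, ← hry, hr]
    congr 1
    push_cast
    ring
  have hdiff : |yh - y| ≤ ε := abs_le.2 ⟨by linarith, by linarith⟩
  have he0 : ‖Wh 0 - Complex.exp (y * Complex.I)‖ ≤ 4 * ε + 2 * y ^ 2 := by
    have h1 := Complex.norm_le_two_mul_of_abs_re_im_le h0re h0im
    have h2 := norm_one_sub_sq_add_mul_I_sub_le (y := y) (y' := yh)
      (abs_le.2 ⟨by linarith, by linarith⟩)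
    have h3 := norm_one_sub_sq_add_mul_I_sub_exp_le (y := y)
      (abs_le.2 ⟨by linarith, by linarith⟩)
    have h4 := norm_sub_le_norm_sub_add_norm_sub (Wh 0) (1 - (yh : ℂ) ^ 2 + yh * Complex.I)
      (Complex.exp (y * Complex.I))
    have h5 := norm_sub_le_norm_sub_add_norm_sub (1 - (yh : ℂ) ^ 2 + yh * Complex.I)
      (1 - (y : ℂ) ^ 2 + y * Complex.I) (Complex.exp (y * Complex.I))
    linarith
  have hry2 : r * y ^ 2 ≤ 1 / 32 / 2 ^ ν := by
    have h : r * y ^ 2 = x ^ 2 / 128 / 2 ^ ν := by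
      rw [hy, hr']
      field_simp
    have hx128 : x ^ 2 / 128 ≤ 1 / 32 := by nlinarith
    rw [h]
    gcongr
  have him : |Real.sin x - (Wh (ν + 7)).im| ≤ ‖Wh (ν + 7) - Complex.exp (x * Complex.I)‖ := by
    have h := Complex.abs_im_le_norm (Wh (ν + 7) - Complex.exp (x * Complex.I))
    rwa [Complex.sub_im, Complex.exp_ofReal_mul_I_im, abs_sub_comm] at h
  rw [hexp, ← hr] at hmain
  have hmul : r * (‖Wh 0 - Complex.exp (y * Complex.I)‖ + 2 * ε) ≤
      6 * (r * ε) + 2 * (r * y ^ 2) := by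
    calc _ ≤ r * ((4 * ε + 2 * y ^ 2) + 2 * ε) := by gcongr
      _ = _ := by ring
  have hq : 0 < 1 / (2 : ℝ) ^ ν := by positivity
  rw [hgoal]
  rw [div_eq_mul_one_div] at hrε hry2 ⊢
  linarith
end
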